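/- arXiv:math/9805025 — 5 statements merged into one kernel-verified Lean document; each statement's English description precedes it below -/
import Mathlib

section
/- Let μ > 0, s = √μ, let ξ : [0,∞) → ℝ be continuous, set q(x) = ξ(x) cos x, and let θ be the Prüfer angle for q. Let α, β be real numbers and let F : [0,∞) → ℝ be continuously differentiable with F(x) → 0 as x → ∞. If the improper integrals I(F,α,β), J(F′,α,β) and K(Fξ,α,β) all converge, then (αs+β)·I(F,α,β) = F(0) + J(F′,α,β) + α s⁻¹ K(Fξ,α,β). -/
open Real Filter MeasureTheory intervalIntegral

theorem integration_by_parts_I (μ s : ℝ) (hμ : 0 < μ) (hs : s = Real.sqrt μ)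
    (ξ q θ : ℝ → ℝ)
    (hξ : ContinuousOn ξ (Set.Ici 0))
    (hq : ∀ x, q x = ξ x * Real.cos x)
    (hθ0 : θ 0 = 0)
    (hθ : ∀ x ∈ Set.Ici (0 : ℝ),
      HasDerivAt θ (s - s⁻¹ * q x * Real.sin (θ x) ^ 2) x)
    (α β : ℝ) (F F' : ℝ → ℝ)
    (hF : ∀ x ∈ Set.Ici (0 : ℝ), HasDerivAt F (F' x) x)
    (hF' : ContinuousOn F' (Set.Ici 0))
    (hFlim : Tendsto F atTop (nhds 0))
    (IV JV KV : ℝ)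
    (hI : Tendsto (fun T => ∫ x in (0 : ℝ)..T,
      F x * Real.sin (α * θ x + β * x)) atTop (nhds IV))
    (hJ : Tendsto (fun T => ∫ x in (0 : ℝ)..T,
      F' x * Real.cos (α * θ x + β * x)) atTop (nhds JV))
    (hK : Tendsto (fun T => ∫ x in (0 : ℝ)..T,
      (F x * ξ x) * Real.cos x * Real.sin (θ x) ^ 2 * Real.sin (α * θ x + β * x))
      atTop (nhds KV)) :
    (α * s + β) * IV = F 0 + JV + α * s⁻¹ * KV := by
  have hθc : ContinuousOn θ (Set.Ici 0) := fun x hx =>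
    (hθ x hx).continuousAt.continuousWithinAt
  have hFc : ContinuousOn F (Set.Ici 0) := fun x hx =>
    (hF x hx).continuousAt.continuousWithinAt
  have hd : ∀ x ∈ Set.Ici (0 : ℝ),
      HasDerivAt (fun x => F x * Real.cos (α * θ x + β * x))
        (F' x * Real.cos (α * θ x + β * x)
          - (α * s + β) * (F x * Real.sin (α * θ x + β * x))
          + α * s⁻¹ * ((F x * ξ x) * Real.cos x * Real.sin (θ x) ^ 2
            * Real.sin (α * θ x + β * x))) x := by
    intro x hx
    have hphase := ((hθ x hx).const_mul α).add ((hasDerivAt_id x).const_mul β)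
    refine ((hF x hx).mul hphase.cos).congr_deriv ?_
    simp only [hq, Pi.add_apply, id]
    ring
  have hparts : ∀ T : ℝ, 0 ≤ T →
      F T * Real.cos (α * θ T + β * T) - F 0 =
        (∫ x in (0 : ℝ)..T, F' x * Real.cos (α * θ x + β * x))
        - (α * s + β) * (∫ x in (0 : ℝ)..T, F x * Real.sin (α * θ x + β * x))
        + α * s⁻¹ * (∫ x in (0 : ℝ)..T, (F x * ξ x) * Real.cos x * Real.sin (θ x) ^ 2
            * Real.sin (α * θ x + β * x)) := by
    intro T hT
    have hsub : Set.uIcc 0 T ⊆ Set.Ici (0 : ℝ) := by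
      rw [Set.uIcc_of_le hT]
      exact Set.Icc_subset_Ici_self
    have hJi : IntervalIntegrable (fun x => F' x * Real.cos (α * θ x + β * x))
        volume 0 T :=
      ContinuousOn.intervalIntegrable (ContinuousOn.mono (by fun_prop) hsub)
    have hIi : IntervalIntegrable (fun x => F x * Real.sin (α * θ x + β * x))
        volume 0 T :=
      ContinuousOn.intervalIntegrable (ContinuousOn.mono (by fun_prop) hsub)
    have hKi : IntervalIntegrable (fun x => (F x * ξ x) * Real.cos x * Real.sin (θ x) ^ 2
        * Real.sin (α * θ x + β * x)) volume 0 T :=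
      ContinuousOn.intervalIntegrable (ContinuousOn.mono (by fun_prop) hsub)
    have hftc := integral_eq_sub_of_hasDerivAt (fun x hx => hd x (hsub hx))
      ((hJi.sub (hIi.const_mul (α * s + β))).add (hKi.const_mul (α * s⁻¹)))
    rw [intervalIntegral.integral_add (hJi.sub (hIi.const_mul _)) (hKi.const_mul _),
      intervalIntegral.integral_sub hJi (hIi.const_mul _),
      intervalIntegral.integral_const_mul, intervalIntegral.integral_const_mul] at hftc
    simpa [hθ0] using hftc.symm
  have hboundary : Tendsto (fun T => F T * Real.cos (α * θ T + β * T)) atTop (nhds 0) := by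
    refine squeeze_zero_norm (fun T => ?_) (tendsto_zero_iff_norm_tendsto_zero.mp hFlim)
    rw [norm_mul]
    exact mul_le_of_le_one_right (norm_nonneg _) (Real.abs_cos_le_one _)
  have hlim := (hJ.sub (hI.const_mul (α * s + β))).add (hK.const_mul (α * s⁻¹))
  have heq := tendsto_nhds_unique
    ((hboundary.sub_const (F 0)).congr'
      ((eventually_ge_atTop 0).mono fun T hT => hparts T hT)) hlim
  linarith
end

section
/- Let μ > 0, s = √μ, let ξ : [0,∞) → ℝ be continuous, set q(x) = ξ(x) cos x, and let θ be the Prüfer angle for q. Let α, β be real numbers and let F : [0,∞) → ℝ be continuously differentiable with F(x) → 0 as x → ∞. If the improper integrals J(F,α,β), I(F′,α,β) and L(Fξ,α,β) all converge, then (αs+β)·J(F,α,β) = −I(F′,α,β) + α s⁻¹ L(Fξ,α,β). -/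
open Real Filter MeasureTheory intervalIntegral

theorem integration_by_parts_J (μ s : ℝ) (hμ : 0 < μ) (hs : s = Real.sqrt μ)
    (ξ q θ : ℝ → ℝ)
    (hξ : ContinuousOn ξ (Set.Ici 0))
    (hq : ∀ x, q x = ξ x * Real.cos x)
    (hθ0 : θ 0 = 0)
    (hθ : ∀ x ∈ Set.Ici (0 : ℝ),
      HasDerivAt θ (s - s⁻¹ * q x * Real.sin (θ x) ^ 2) x)
    (α β : ℝ) (F F' : ℝ → ℝ)
    (hF : ∀ x ∈ Set.Ici (0 : ℝ), HasDerivAt F (F' x) x)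
    (hF' : ContinuousOn F' (Set.Ici 0))
    (hFlim : Tendsto F atTop (nhds 0))
    (JV IV LV : ℝ)
    (hJ : Tendsto (fun T => ∫ x in (0 : ℝ)..T,
      F x * Real.cos (α * θ x + β * x)) atTop (nhds JV))
    (hI : Tendsto (fun T => ∫ x in (0 : ℝ)..T,
      F' x * Real.sin (α * θ x + β * x)) atTop (nhds IV))
    (hL : Tendsto (fun T => ∫ x in (0 : ℝ)..T,
      (F x * ξ x) * Real.cos x * Real.sin (θ x) ^ 2 * Real.cos (α * θ x + β * x))
      atTop (nhds LV)) :
    (α * s + β) * JV = -IV + α * s⁻¹ * LV := by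
  have hFc : ContinuousOn F (Set.Ici 0) := fun x hx => (hF x hx).continuousAt.continuousWithinAt
  have hθc : ContinuousOn θ (Set.Ici 0) := fun x hx => (hθ x hx).continuousAt.continuousWithinAt
  have hφc : ContinuousOn (fun x => α * θ x + β * x) (Set.Ici 0) := by fun_prop
  have hint : ∀ {f : ℝ → ℝ} {T : ℝ}, 0 ≤ T → ContinuousOn f (Set.Ici 0) →
      IntervalIntegrable f volume 0 T := fun hT hf =>
    (hf.mono (by rw [Set.uIcc_of_le hT]; exact Set.Icc_subset_Ici_self)).intervalIntegrable
  have hId : Tendsto (fun T => F T * Real.sin (α * θ T + β * T)) atTop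
      (nhds (IV + (α * s + β) * JV - α * s⁻¹ * LV)) := by
    refine ((hI.add (hJ.const_mul (α * s + β))).sub (hL.const_mul (α * s⁻¹))).congr' ?_
    filter_upwards [eventually_ge_atTop 0] with T hT
    have h1 := hint (f := fun x => F' x * Real.sin (α * θ x + β * x)) hT (by fun_prop)
    have h2 := (hint (f := fun x => F x * Real.cos (α * θ x + β * x)) hT
      (by fun_prop)).const_mul (α * s + β)
    have h3 := (hint (f := fun x => (F x * ξ x) * Real.cos x * Real.sin (θ x) ^ 2 *
      Real.cos (α * θ x + β * x)) hT (by fun_prop)).const_mul (α * s⁻¹)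
    rw [← intervalIntegral.integral_const_mul, ← intervalIntegral.integral_const_mul,
      ← intervalIntegral.integral_add h1 h2, ← intervalIntegral.integral_sub (h1.add h2) h3,
      intervalIntegral.integral_eq_sub_of_hasDerivAt
        (f := fun x => F x * Real.sin (α * θ x + β * x)) ?_ ((h1.add h2).sub h3)]
    · simp [hθ0]
    · intro x hx
      rw [Set.uIcc_of_le hT] at hx
      have hφ : HasDerivAt (fun x => α * θ x + β * x) _ x :=
        ((hθ x hx.1).const_mul α).add ((hasDerivAt_id x).const_mul β)
      refine ((hF x hx.1).mul hφ.sin).congr_deriv ?_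
      rw [hq]
      ring
  have h0 : Tendsto (fun T => F T * Real.sin (α * θ T + β * T)) atTop (nhds 0) := by
    refine squeeze_zero_norm (fun T => ?_) (tendsto_zero_iff_norm_tendsto_zero.1 hFlim)
    rw [norm_mul]
    exact mul_le_of_le_one_right (norm_nonneg _) (Real.abs_sin_le_one _)
  linarith [tendsto_nhds_unique hId h0]
end

section
/- Let μ > 0, let φ : [0,∞) → ℝ be any real-valued function, and let a, b ∈ ℂ. Suppose y : [0,∞) → ℝ is a real-valued differentiable function with real-valued derivative such that y(x) − (a·e^{iφ(x)} + b·e^{−iφ(x)}) → 0 and y'(x) − i√μ·(a·e^{iφ(x)} − b·e^{−iφ(x)}) → 0 as x → ∞. Then b equals the complex conjugate of a. -/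
open Filter Complex

theorem multiplier_conjugate (μ : ℝ) (hμ : 0 < μ)
    (φ : ℝ → ℝ) (a b : ℂ) (y y' : ℝ → ℝ)
    (hy : ∀ x ∈ Set.Ici (0 : ℝ), HasDerivAt y (y' x) x)
    (h1 : Tendsto (fun x => (y x : ℂ)
      - (a * Complex.exp (Complex.I * (φ x : ℂ))
        + b * Complex.exp (-(Complex.I * (φ x : ℂ))))) atTop (nhds 0))
    (h2 : Tendsto (fun x => (y' x : ℂ)
      - Complex.I * (Real.sqrt μ : ℂ) *
        (a * Complex.exp (Complex.I * (φ x : ℂ))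
          - b * Complex.exp (-(Complex.I * (φ x : ℂ))))) atTop (nhds 0)) :
    b = starRingEnd ℂ a := by
  have hs : (Real.sqrt μ : ℂ) ≠ 0 := by
    exact_mod_cast (Real.sqrt_pos.mpr hμ).ne'
  have g1 := h1.sub ((continuous_conj.tendsto 0).comp h1)
  have g2 := h2.sub ((continuous_conj.tendsto 0).comp h2)
  have key := ((g1.const_mul (Complex.I * (Real.sqrt μ : ℂ))).add g2).norm
  have hconj : ∀ x : ℝ, starRingEnd ℂ (Complex.exp (Complex.I * (φ x : ℂ)))
      = Complex.exp (-(Complex.I * (φ x : ℂ))) := by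
    intro x
    rw [← Complex.exp_conj]
    simp
  have hconj' : ∀ x : ℝ, starRingEnd ℂ (Complex.exp (-(Complex.I * (φ x : ℂ))))
      = Complex.exp (Complex.I * (φ x : ℂ)) := by
    intro x
    rw [← hconj, Complex.conj_conj]
  have hconst : Tendsto (fun _ : ℝ =>
      ‖-2 * (Complex.I * (Real.sqrt μ : ℂ)) * (a - starRingEnd ℂ b)‖) atTop (nhds 0) := by
    simp only [map_zero, sub_zero, mul_zero, add_zero, norm_zero] at key
    refine key.congr fun x => ?_
    have hE : ‖Complex.exp (Complex.I * (φ x : ℂ))‖ = 1 := by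
      rw [mul_comm]
      exact Complex.norm_exp_ofReal_mul_I _
    rw [← mul_one ‖-2 * (Complex.I * (Real.sqrt μ : ℂ)) * (a - starRingEnd ℂ b)‖, ← hE,
      ← norm_mul]
    congr 1
    simp only [Function.comp_apply, map_sub, map_add, map_mul, hconj, hconj',
      Complex.conj_ofReal, Complex.conj_I]
    ring
  have hzero := norm_eq_zero.mp (tendsto_nhds_unique tendsto_const_nhds hconst)
  have hab : a - starRingEnd ℂ b = 0 := by
    simpa [hs] using hzero
  rw [sub_eq_zero.mp hab, Complex.conj_conj]
end

section
/- Let μ > 0 and let φ : [0,∞) → ℝ be any real-valued function. Let b₁, b₂ ∈ ℂ and suppose y₁, y₂ : [0,∞) → ℝ are real-valued differentiable functions such that, for j = 1, 2, y_j(x) − (conj(b_j)·e^{iφ(x)} + b_j·e^{−iφ(x)}) → 0 and y_j'(x) − i√μ·(conj(b_j)·e^{iφ(x)} − b_j·e^{−iφ(x)}) → 0 as x → ∞. If the Wronskian satisfies y₁(x)·y₂'(x) − y₁'(x)·y₂(x) = 1 for all x ≥ 0, then Im(conj(b₂)·b₁) = −1/(4√μ). -/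
open Filter Complex

/-- If `u` and `v` are asymptotic to bounded functions `a` and `b`, then `u * v` is asymptotic to
`a * b`. -/
theorem tendsto_mul_sub_mul_of_bounded {α R : Type*} [NormedCommRing R] {l : Filter α}
    {u v a b : α → R} {A B : ℝ}
    (hu : Tendsto (fun x => u x - a x) l (nhds 0)) (hv : Tendsto (fun x => v x - b x) l (nhds 0))
    (ha : ∀ x, ‖a x‖ ≤ A) (hb : ∀ x, ‖b x‖ ≤ B) :
    Tendsto (fun x => u x * v x - a x * b x) l (nhds 0) := by
  have hub := hu.zero_mul_isBoundedUnder_le (isBoundedUnder_of ⟨B, hb⟩)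
  have hav := hv.zero_mul_isBoundedUnder_le (isBoundedUnder_of ⟨A, ha⟩)
  convert (hub.add hav).add (hu.mul hv) using 2
  · ring
  · simp

theorem norm_mul_exp_I_add_le (b c : ℂ) (t : ℝ) :
    ‖b * Complex.exp (Complex.I * (t : ℂ)) + c * Complex.exp (-(Complex.I * (t : ℂ)))‖
      ≤ ‖b‖ + ‖c‖ := by
  have h : -(Complex.I * (t : ℂ)) = Complex.I * ((-t : ℝ) : ℂ) := by push_cast; ring
  refine (norm_add_le _ _).trans_eq ?_
  rw [h, norm_mul, norm_mul, Complex.norm_exp_I_mul_ofReal, Complex.norm_exp_I_mul_ofReal,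
    mul_one, mul_one]

theorem norm_mul_exp_I_sub_le (k b c : ℂ) (t : ℝ) :
    ‖k * (b * Complex.exp (Complex.I * (t : ℂ)) - c * Complex.exp (-(Complex.I * (t : ℂ))))‖
      ≤ ‖k‖ * (‖b‖ + ‖c‖) := by
  rw [norm_mul]
  gcongr
  simpa [sub_eq_add_neg] using norm_mul_exp_I_add_le b (-c) t

/-- The Wronskian of two asymptotic wave profiles does not depend on their common phase. -/
theorem wronskian_wave_profile (s : ℝ) (b₁ b₂ z : ℂ) :
    (starRingEnd ℂ b₁ * Complex.exp z + b₁ * Complex.exp (-z))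
        * (Complex.I * s * (starRingEnd ℂ b₂ * Complex.exp z - b₂ * Complex.exp (-z)))
      - (Complex.I * s * (starRingEnd ℂ b₁ * Complex.exp z - b₁ * Complex.exp (-z)))
        * (starRingEnd ℂ b₂ * Complex.exp z + b₂ * Complex.exp (-z))
      = ((-(4 * s * (starRingEnd ℂ b₂ * b₁).im) : ℝ) : ℂ) := by
  have hz : Complex.exp z * Complex.exp (-z) = 1 := by rw [← Complex.exp_add]; simp
  have him : starRingEnd ℂ b₂ * b₁ - b₂ * starRingEnd ℂ b₁
      = 2 * ((starRingEnd ℂ b₂ * b₁).im : ℂ) * Complex.I := by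
    simpa using Complex.sub_conj (starRingEnd ℂ b₂ * b₁)
  push_cast
  linear_combination
    2 * Complex.I * s * (starRingEnd ℂ b₂ * b₁ - b₂ * starRingEnd ℂ b₁) * hz
      + 2 * Complex.I * s * him + 4 * s * ((starRingEnd ℂ b₂ * b₁).im : ℂ) * Complex.I_sq

theorem wronskian_multiplier (μ : ℝ) (hμ : 0 < μ)
    (φ : ℝ → ℝ) (b₁ b₂ : ℂ) (y₁ y₂ y₁' y₂' : ℝ → ℝ)
    (hy₁ : ∀ x ∈ Set.Ici (0 : ℝ), HasDerivAt y₁ (y₁' x) x)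
    (hy₂ : ∀ x ∈ Set.Ici (0 : ℝ), HasDerivAt y₂ (y₂' x) x)
    (h1 : Tendsto (fun x => (y₁ x : ℂ)
      - (starRingEnd ℂ b₁ * Complex.exp (Complex.I * (φ x : ℂ))
        + b₁ * Complex.exp (-(Complex.I * (φ x : ℂ))))) atTop (nhds 0))
    (h1' : Tendsto (fun x => (y₁' x : ℂ)
      - Complex.I * (Real.sqrt μ : ℂ) *
        (starRingEnd ℂ b₁ * Complex.exp (Complex.I * (φ x : ℂ))
          - b₁ * Complex.exp (-(Complex.I * (φ x : ℂ))))) atTop (nhds 0))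
    (h2 : Tendsto (fun x => (y₂ x : ℂ)
      - (starRingEnd ℂ b₂ * Complex.exp (Complex.I * (φ x : ℂ))
        + b₂ * Complex.exp (-(Complex.I * (φ x : ℂ))))) atTop (nhds 0))
    (h2' : Tendsto (fun x => (y₂' x : ℂ)
      - Complex.I * (Real.sqrt μ : ℂ) *
        (starRingEnd ℂ b₂ * Complex.exp (Complex.I * (φ x : ℂ))
          - b₂ * Complex.exp (-(Complex.I * (φ x : ℂ))))) atTop (nhds 0))
    (hW : ∀ x ∈ Set.Ici (0 : ℝ), y₁ x * y₂' x - y₁' x * y₂ x = 1) :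
    (starRingEnd ℂ b₂ * b₁).im = -(1 / (4 * Real.sqrt μ)) := by
  have hlim := (tendsto_mul_sub_mul_of_bounded h1 h2'
    (fun x => norm_mul_exp_I_add_le _ _ (φ x)) (fun x => norm_mul_exp_I_sub_le _ _ _ (φ x))).sub
    (tendsto_mul_sub_mul_of_bounded h1' h2
    (fun x => norm_mul_exp_I_sub_le _ _ _ (φ x)) (fun x => norm_mul_exp_I_add_le _ _ (φ x)))
  have hconst : Tendsto (fun _ : ℝ => (1 : ℂ)
      - ((-(4 * Real.sqrt μ * (starRingEnd ℂ b₂ * b₁).im) : ℝ) : ℂ)) atTop (nhds (0 - 0)) := by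
    refine hlim.congr' ?_
    filter_upwards [eventually_ge_atTop (0 : ℝ)] with x hx
    have hWx : (y₁ x : ℂ) * y₂' x - y₁' x * y₂ x = 1 := by exact_mod_cast hW x hx
    rw [← wronskian_wave_profile _ _ _ (Complex.I * (φ x : ℂ)), ← hWx]
    ring
  have heq := tendsto_nhds_unique tendsto_const_nhds hconst
  rw [sub_zero, sub_eq_zero] at heq
  have hreal : 1 = -(4 * Real.sqrt μ * (starRingEnd ℂ b₂ * b₁).im) := by exact_mod_cast heq
  have hs : Real.sqrt μ ≠ 0 := (Real.sqrt_pos.mpr hμ).ne'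
  rw [eq_neg_iff_add_eq_zero]
  field_simp
  linarith
end

section
/- Let X ∈ ℝ, δ > 0, and let ν : [X,∞) → ℂ be continuous with Re ν(t) ≤ −δ for all t ≥ X. Let y₁, y₂ : [X,∞) → ℂ be continuous functions and b₁, b₂ ∈ ℂ with b₂ ≠ 0 such that y_j(x)·exp(∫_X^x ν(t) dt) → b_j as x → ∞ for j = 1, 2. If m ∈ ℂ is such that y₁ + m·y₂ is square-integrable on [X,∞), then m = −b₁/b₂. -/
open Filter MeasureTheory intervalIntegral

/-- The exponential of an integral of a function with nonpositive real part lies in the closed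
unit disc. -/
theorem norm_exp_intervalIntegral_le_one {ν : ℝ → ℂ} {a b : ℝ} (hab : a ≤ b)
    (hν : IntervalIntegrable ν volume a b) (hre : ∀ t ∈ Set.Ioc a b, (ν t).re ≤ 0) :
    ‖Complex.exp (∫ t in a..b, ν t)‖ ≤ 1 := by
  have hcomm : ∫ t in a..b, (ν t).re = (∫ t in a..b, ν t).re :=
    Complex.reCLM.intervalIntegral_comp_comm hν
  rw [Complex.norm_exp, Real.exp_le_one_iff, ← hcomm, intervalIntegral.integral_of_le hab]
  exact setIntegral_nonpos measurableSet_Ioc hre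

/-- An integrable function on a half-line is not eventually bounded below by a positive
constant. -/
theorem not_eventually_le_of_integrableOn_Ici {g : ℝ → ℝ} {X c : ℝ} (hc : 0 < c)
    (hg : IntegrableOn g (Set.Ici X)) : ¬ ∀ᶠ x in atTop, c ≤ g x := by
  intro h
  obtain ⟨A, hA⟩ := eventually_atTop.1 h
  have hgA : IntegrableOn g (Set.Ici (max A X)) :=
    hg.mono_set (Set.Ici_subset_Ici.2 (le_max_right A X))
  have hconst : IntegrableOn (fun _ : ℝ => c) (Set.Ici (max A X)) := by
    refine Integrable.mono' hgA aestronglyMeasurable_const ?_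
    filter_upwards [ae_restrict_mem measurableSet_Ici] with x hx
    rw [Real.norm_of_nonneg hc.le]
    exact hA x ((le_max_left A X).trans hx)
  simp [integrableOn_const_iff, hc.ne'] at hconst

theorem m_function_formula (X δ : ℝ) (hδ : 0 < δ) (ν : ℝ → ℂ)
    (hν : ContinuousOn ν (Set.Ici X))
    (hre : ∀ t ∈ Set.Ici X, (ν t).re ≤ -δ)
    (y₁ y₂ : ℝ → ℂ)
    (hy₁c : ContinuousOn y₁ (Set.Ici X))
    (hy₂c : ContinuousOn y₂ (Set.Ici X))
    (b₁ b₂ : ℂ) (hb₂ : b₂ ≠ 0)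
    (h₁ : Tendsto (fun x => y₁ x * Complex.exp (∫ t in X..x, ν t)) atTop (nhds b₁))
    (h₂ : Tendsto (fun x => y₂ x * Complex.exp (∫ t in X..x, ν t)) atTop (nhds b₂))
    (m : ℂ)
    (hm : IntegrableOn (fun x => ‖y₁ x + m * y₂ x‖ ^ 2) (Set.Ici X)) :
    m = -b₁ / b₂ := by
  by_contra hne
  have hL : 0 < ‖b₁ + m * b₂‖ := by
    rw [norm_pos_iff]
    intro h
    exact hne ((eq_div_iff hb₂).2 (by linear_combination h))
  have hlim := (h₁.add (h₂.const_mul m)).norm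
  refine not_eventually_le_of_integrableOn_Ici (pow_pos (half_pos hL) 2) hm ?_
  filter_upwards [hlim.eventually_const_lt (half_lt_self hL), eventually_ge_atTop X] with x hx hXx
  have hexp : ‖Complex.exp (∫ t in X..x, ν t)‖ ≤ 1 := by
    refine norm_exp_intervalIntegral_le_one hXx ?_ fun t ht => ?_
    · refine (hν.mono ?_).intervalIntegrable_of_Icc hXx
      exact Set.Icc_subset_Ici_self
    · linarith [hre t ht.1.le]
  refine pow_le_pow_left₀ (half_pos hL).le (hx.le.trans ?_) 2
  calc _ = ‖y₁ x + m * y₂ x‖ * ‖Complex.exp (∫ t in X..x, ν t)‖ := by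
        rw [← norm_mul]
        congr 1
        ring
    _ ≤ ‖y₁ x + m * y₂ x‖ := mul_le_of_le_one_right (norm_nonneg _) hexp
end
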